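/- arXiv:2207.06739 — 11 statements merged into one kernel-verified Lean document; each statement's English description precedes it below -/
import Mathlib

section
/- Let (H, ⊞, 0) satisfy conditions (1)–(3) of a hypergroup (commutativity, associativity, 0 neutral, unique hypernegatives), reversibility not being assumed. Then for all a₁, a₂, a₃ ∈ H: a₁ ∈ a₂ ⊞ (−a₃) if and only if a₃ ∈ a₂ ⊞ (−a₁). -/
/-- In a structure (H, ⊞, 0) satisfying conditions (1)–(3) of a hypergroup
(commutativity, associativity, 0 neutral, unique hypernegatives), for all a₁ a₂ a₃ :
a₁ ∈ a₂ ⊞ (−a₃) iff a₃ ∈ a₂ ⊞ (−a₁). -/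
theorem stmt_0 {H : Type*} (z : H) (add : H → H → Set H) (neg : H → H)
    (hne : ∀ a b : H, (add a b).Nonempty)
    (hcomm : ∀ a b : H, add a b = add b a)
    (hassoc : ∀ a b c : H, (⋃ x ∈ add a b, add x c) = (⋃ y ∈ add b c, add a y))
    (hzero : ∀ a : H, add z a = {a})
    (hneg : ∀ a b : H, z ∈ add a b ↔ b = neg a) :
    ∀ a₁ a₂ a₃ : H, a₁ ∈ add a₂ (neg a₃) ↔ a₃ ∈ add a₂ (neg a₁) := by
  have hmem : ∀ a b : H, z ∈ add a (neg b) ↔ a = b := by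
    have hinv : ∀ a : H, neg (neg a) = a := fun a =>
      ((hneg (neg a) a).1 (hcomm a (neg a) ▸ (hneg a (neg a)).2 rfl)).symm
    intro a b
    rw [hcomm, hneg, hinv]
  have key : ∀ a b c : H, a ∈ add b (neg c) ↔ z ∈ ⋃ y ∈ add (neg c) (neg a), add b y := by
    intro a b c
    simp [← hassoc, hmem]
  intro a₁ a₂ a₃
  rw [key, key, hcomm (neg a₃)]
end

section
/- Let (H, ⊞, 0) satisfy conditions (1)–(3) of a hypergroup (commutativity, associativity, 0 neutral, unique hypernegatives). Then the reversibility condition (for all a₁,a₂,a₃ ∈ H: a₁ ∈ a₂ ⊞ a₃ if and only if a₃ ∈ a₁ ⊞ (−a₂)) holds if and only if the hypernegation is an additive morphism, i.e. for all a, b ∈ H the elementwise negation {−s : s ∈ a ⊞ b} equals (−a) ⊞ (−b). -/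
/-- In a multivalued structure with associative addition and unique hypernegatives,
the summand on the left can be exchanged with the sum at the cost of negating both. -/
lemma neg_mem_add_neg_of_mem_add {H : Type*} {z : H} {add : H → H → Set H} {neg : H → H}
    (hassoc : ∀ a b c : H, (⋃ x ∈ add a b, add x c) = (⋃ y ∈ add b c, add a y))
    (hneg : ∀ a b : H, z ∈ add a b ↔ b = neg a) {a b s : H} (h : s ∈ add a b) :
    neg a ∈ add b (neg s) := by
  have hz : z ∈ ⋃ x ∈ add a b, add x (neg s) := Set.mem_biUnion h ((hneg _ _).2 rfl)
  rw [hassoc] at hz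
  obtain ⟨y, hy, hzy⟩ := Set.mem_iUnion₂.1 hz
  rwa [← (hneg _ _).1 hzy]

/-- For (H, ⊞, 0) satisfying conditions (1)–(3) of a hypergroup, the
reversibility condition (a₁ ∈ a₂ ⊞ a₃ ↔ a₃ ∈ a₁ ⊞ (−a₂)) holds iff hypernegation is an
additive morphism: the elementwise negation of a ⊞ b equals (−a) ⊞ (−b) for all a, b. -/
theorem stmt_2 {H : Type*} (z : H) (add : H → H → Set H) (neg : H → H)
    (hne : ∀ a b : H, (add a b).Nonempty)
    (hcomm : ∀ a b : H, add a b = add b a)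
    (hassoc : ∀ a b c : H, (⋃ x ∈ add a b, add x c) = (⋃ y ∈ add b c, add a y))
    (hzero : ∀ a : H, add z a = {a})
    (hneg : ∀ a b : H, z ∈ add a b ↔ b = neg a) :
    (∀ a₁ a₂ a₃ : H, a₁ ∈ add a₂ a₃ ↔ a₃ ∈ add a₁ (neg a₂)) ↔
      (∀ a b : H, neg '' (add a b) = add (neg a) (neg b)) := by
  have hinv : ∀ a, neg (neg a) = a := fun a =>
    ((hneg _ _).1 (hcomm a (neg a) ▸ (hneg a _).2 rfl)).symm
  have hexch : ∀ {a b s : H}, s ∈ add a b → neg a ∈ add b (neg s) :=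
    neg_mem_add_neg_of_mem_add hassoc hneg
  constructor
  · intro hrev
    have hmem : ∀ {a b s : H}, s ∈ add a b → neg s ∈ add (neg a) (neg b) :=
      fun h => (hrev _ _ _).1 (hexch h)
    intro a b
    ext t
    constructor
    · rintro ⟨s, hs, rfl⟩
      exact hmem hs
    · intro ht
      exact ⟨neg t, by simpa only [hinv] using hmem ht, hinv t⟩
  · intro hmor
    have hfwd : ∀ {a b s : H}, s ∈ add a b → b ∈ add s (neg a) := by
      intro a b s h
      have hb : neg b ∈ add (neg s) a := by simpa only [hinv] using hexch (hexch h)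
      have hb' := Set.mem_image_of_mem neg hb
      rwa [hmor, hinv, hinv] at hb'
    refine fun a₁ a₂ a₃ => ⟨hfwd, fun h => ?_⟩
    rw [hcomm] at h ⊢
    simpa only [hinv] using hfwd h
end

section
/- Let A be a semiring, T a submonoid of the multiplicative monoid of A with 1 ∈ T and 0 ∉ T, and n : A → A an additive monoid homomorphism with n ∘ n = id satisfying n(x·y) = x·n(y) = n(x)·y for all x, y ∈ A and n(T) ⊆ T. Assume: ((−)-bipotence) for all a, b ∈ T with b ≠ n(a), a + b = a or a + b = b; (cancellativity) for all a ∈ T and c, c' ∈ A, a·c = a·c' implies c = c'; and T ∩ {b + n(b) : b ∈ A} = ∅. Then for all a, a' ∈ T, a + n(a) = a' + n(a') implies a' = a or a' = n(a). -/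
/-- Let A be a semiring, T a submonoid of the multiplicative monoid of A with
1 ∈ T and 0 ∉ T, and n a negation map (additive, of order ≤ 2, compatible with
multiplication, preserving T). Under (−)-bipotence, cancellativity of the T-action, and
T ∩ {b + n(b)} = ∅, a + n(a) = a' + n(a') for a, a' ∈ T implies a' = a or a' = n(a). -/
theorem stmt_8 {A : Type*} [Semiring A] (T : Set A) (n : A → A)
    (hT1 : (1 : A) ∈ T)
    (hTmul : ∀ a ∈ T, ∀ b ∈ T, a * b ∈ T)
    (hT0 : (0 : A) ∉ T)
    (hn0 : n 0 = 0)
    (hnadd : ∀ x y : A, n (x + y) = n x + n y)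
    (hnn : ∀ x : A, n (n x) = x)
    (hnmull : ∀ x y : A, n (x * y) = x * n y)
    (hnmulr : ∀ x y : A, n (x * y) = n x * y)
    (hnT : ∀ a ∈ T, n a ∈ T)
    (hbipot : ∀ a ∈ T, ∀ b ∈ T, b ≠ n a → a + b = a ∨ a + b = b)
    (hcanc : ∀ a ∈ T, ∀ c c' : A, a * c = a * c' → c = c')
    (hdisj : ∀ b : A, b + n b ∉ T) :
    ∀ a ∈ T, ∀ a' ∈ T, a + n a = a' + n a' → a' = a ∨ a' = n a := by
  have add_self_of_ne : ∀ a ∈ T, a ≠ n a → a + a = a := fun a ha h => by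
    simpa using hbipot a ha a ha h
  have n_eq_self : ∀ a ∈ T, a = n a → ∀ x, n x = x := fun a ha h x => by
    have h1 : n 1 = 1 := hcanc a ha _ _ (by rw [← hnmull, mul_one, ← h])
    rw [← mul_one x, hnmull, h1]
  have absorb : ∀ a ∈ T, ∀ b ∈ T, a + n a = b + n b → b ≠ a → a + b = a → False := by
    intro a ha b hb hab hne hsum
    have hne' : n b ≠ n a := fun h => hne (by rw [← hnn b, h, hnn])
    rcases hbipot a ha (n b) (hnT b hb) hne' with h | h
    · have h3 : a + (a + n a) = a := by rw [hab, ← add_assoc, hsum, h]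
      by_cases hna : a = n a
      · have hid := n_eq_self a ha hna
        rw [hid, hid] at hab
        rw [hid] at h3
        have three : (1 : A) + (1 + 1) = 1 :=
          hcanc a ha _ _ (by simpa only [mul_add, mul_one] using h3)
        have hb3 : b + (b + b) = b := by
          simpa only [mul_add, mul_one] using congrArg (b * ·) three
        have hb2 : b + b = b := by
          rw [← hab, add_comm, add_assoc, hsum, hab] at hb3
          exact hb3
        exact hdisj b (by rwa [hid, hb2])
      · rw [← add_assoc, add_self_of_ne a ha hna] at h3
        exact hdisj a (by rwa [h3])
    · have h3 : a + (a + n a) = n b := by rw [hab, ← add_assoc, hsum, h]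
      by_cases hna : a = n a
      · rw [n_eq_self a ha hna b, hsum] at h
        exact hne h.symm
      · rw [← add_assoc, add_self_of_ne a ha hna] at h3
        exact hdisj a (by rw [h3]; exact hnT b hb)
  intro a ha b hb hab
  by_contra! hne
  rcases hbipot a ha b hb hne.2 with h | h
  · exact absorb a ha b hb hab hne.1 h
  · exact absorb b hb a ha hab.symm hne.1.symm (by rwa [add_comm])
end

section
/- Let (A,+,0) be an additive commutative monoid, T ⊆ A, and n : A → A an additive monoid homomorphism with n ∘ n = id and n(T) ⊆ T. Assume: ((−)-bipotence) for all a, b ∈ T with b ≠ n(a), a + b = a or a + b = b; and (∘-idempotence) for all a ∈ T, (a + n(a)) + (a + n(a)) = a + n(a). Then every sum of a nonempty finite list of elements of T is equal to the sum of a nonempty list of at most 3 elements of T. (Any ∘-idempotent (−)-bipotent triple has height ≤ 3.) -/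
/-- Let A be an additive commutative monoid, T ⊆ A, and n a negation map
(additive monoid endomorphism with n ∘ n = id, n(T) ⊆ T). Under (−)-bipotence and
∘-idempotence ((a + n a) + (a + n a) = a + n a for a ∈ T), every sum of a nonempty finite
list of elements of T equals the sum of a nonempty list of at most 3 elements of T. -/
theorem stmt_9 {A : Type*} [AddCommMonoid A] (T : Set A) (n : A → A)
    (hn0 : n 0 = 0)
    (hnadd : ∀ x y : A, n (x + y) = n x + n y)
    (hnn : ∀ x : A, n (n x) = x)
    (hnT : ∀ a ∈ T, n a ∈ T)
    (hbipot : ∀ a ∈ T, ∀ b ∈ T, b ≠ n a → a + b = a ∨ a + b = b)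
    (hidem : ∀ a ∈ T, (a + n a) + (a + n a) = a + n a) :
    ∀ l : List A, l ≠ [] → (∀ x ∈ l, x ∈ T) →
      ∃ m : List A, m ≠ [] ∧ m.length ≤ 3 ∧ (∀ x ∈ m, x ∈ T) ∧ m.sum = l.sum := by
  intro l
  induction l with
  | nil => intro h; exact absurd rfl h
  | cons x t ih =>
    intro _ hT
    have hx : x ∈ T := hT x (by simp)
    by_cases ht : t = []
    · subst ht
      exact ⟨[x], by simp, by simp, by simpa using hx, rfl⟩
    obtain ⟨m, hm, hlen, hmT, hsum⟩ := ih ht fun y hy => hT y (by simp [hy])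
    rw [List.sum_cons, ← hsum]
    match m, hm, hlen, hmT with
    | [a], _, _, hmT => exact ⟨[x, a], by simp, by simp, by simpa [hx] using hmT, by simp⟩
    | [a, b], _, _, hmT =>
      exact ⟨[x, a, b], by simp, by simp, by simpa [hx] using hmT, by simp⟩
    | [a, b, c], _, _, hmT =>
      have ha : a ∈ T := hmT a (by simp)
      have hb : b ∈ T := hmT b (by simp)
      have hc : c ∈ T := hmT c (by simp)
      by_cases hxa : a = n x
      · by_cases hxb : b = n x
        · by_cases hab : b = n a
          · have hax : a = x := by rw [← hnn a, ← hab, hxb, hnn]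
            have hbx : b = x := by rw [hxb, ← hxa, hax]
            have hnx : n x = x := by rw [← hxa, hax]
            have hi := hidem x hx
            rw [hnx] at hi
            by_cases hxc : c = n x
            · refine ⟨[x, x], by simp, by simp, by simpa using hx, ?_⟩
              simp [hax, hbx, hxc, hnx, ← add_assoc] at hi ⊢
              exact hi.symm
            · rcases hbipot x hx c hc hxc with h | h
              · exact ⟨[x, x, x], by simp, by simp, by simpa using hx, by simp [hax, hbx, h]⟩
              · exact ⟨[x, x, c], by simp, by simp, by simp [hx, hc], by simp [hax, hbx, h]⟩
          · rcases hbipot a ha b hb hab with h | h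
            · exact ⟨[x, a, c], by simp, by simp, by simp [hx, ha, hc],
                by simp [← add_assoc a b c, h]⟩
            · exact ⟨[x, b, c], by simp, by simp, by simp [hx, hb, hc],
                by simp [← add_assoc a b c, h]⟩
        · rcases hbipot x hx b hb hxb with h | h
          · exact ⟨[x, a, c], by simp, by simp, by simp [hx, ha, hc],
              by simp [add_left_comm a b c, ← add_assoc x b, h]⟩
          · exact ⟨[b, a, c], by simp, by simp, by simp [hb, ha, hc],
              by simp [add_left_comm a b c, ← add_assoc x b (a + c), h]⟩
      · rcases hbipot x hx a ha hxa with h | h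
        · exact ⟨[x, b, c], by simp, by simp, by simp [hx, hb, hc],
            by simp [← add_assoc x a, h]⟩
        · exact ⟨[a, b, c], by simp, by simp, by simp [ha, hb, hc],
            by simp [← add_assoc x a (b + c), h]⟩
end

section
/- Let A be a semiring, T a submonoid of the multiplicative monoid of A with 1 ∈ T, and n : A → A an additive monoid homomorphism with n ∘ n = id satisfying n(x·y) = x·n(y) = n(x)·y for all x, y ∈ A and n(T) ⊆ T. Assume every element of A is a finite sum of elements of T ∪ {0}, and that ((−)-bipotence) for all a, b ∈ T with b ≠ n(a), a + b = a or a + b = b. Set e := 1 + n(1) and e' := e + 1, and assume e' = e or e' = 1. Then e + e = e (∘-idempotence) and A is shallow: every element of A is either 0, or lies in T, or is of the form a + n(a) for some a ∈ T. -/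
/-- Let A be a semiring, T a multiplicative submonoid with 1 ∈ T, and n a
negation map compatible with multiplication preserving T. If every element of A is a
finite sum of elements of T ∪ {0}, (−)-bipotence holds, and e' = e or e' = 1 (where
e = 1 + n 1, e' = e + 1), then e + e = e and A is shallow. -/
theorem stmt_10 {A : Type*} [Semiring A] (T : Set A) (n : A → A)
    (hT1 : (1 : A) ∈ T)
    (hTmul : ∀ a ∈ T, ∀ b ∈ T, a * b ∈ T)
    (hn0 : n 0 = 0)
    (hnadd : ∀ x y : A, n (x + y) = n x + n y)
    (hnn : ∀ x : A, n (n x) = x)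
    (hnmull : ∀ x y : A, n (x * y) = x * n y)
    (hnmulr : ∀ x y : A, n (x * y) = n x * y)
    (hnT : ∀ a ∈ T, n a ∈ T)
    (hgen : ∀ b : A, ∃ l : List A, (∀ x ∈ l, x ∈ T ∪ {0}) ∧ b = l.sum)
    (hbipot : ∀ a ∈ T, ∀ b ∈ T, b ≠ n a → a + b = a ∨ a + b = b)
    (he' : (1 : A) + n 1 + 1 = 1 + n 1 ∨ (1 : A) + n 1 + 1 = 1) :
    ((1 : A) + n 1) + ((1 : A) + n 1) = (1 : A) + n 1 ∧
      ∀ b : A, b = 0 ∨ b ∈ T ∨ ∃ a ∈ T, b = a + n a := by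
  have hmul (x : A) : x + n x + x = x + n x ∨ x + n x + x = x := by
    have hx : x * n 1 = n x := by rw [← hnmull, mul_one]
    rcases he' with h | h
    · left
      simpa [mul_add, hx] using congrArg (x * ·) h
    · right
      simpa [mul_add, hx] using congrArg (x * ·) h
  have hstep (t : A) (ht : t ∈ T) (b : A) (hb : b = 0 ∨ b ∈ T ∨ ∃ a ∈ T, b = a + n a) :
      b + t = 0 ∨ b + t ∈ T ∨ ∃ a ∈ T, b + t = a + n a := by
    rcases hb with rfl | hb | ⟨a, ha, rfl⟩
    · right; left
      rwa [zero_add]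
    · right
      by_cases h : t = n b
      · exact Or.inr ⟨b, hb, by rw [h]⟩
      · left
        rcases hbipot b hb t ht h with h | h <;> rwa [h]
    · right
      by_cases h₁ : t = a
      · subst h₁
        rcases hmul t with h | h
        · exact Or.inr ⟨t, ha, h⟩
        · left; rwa [h]
      by_cases h₂ : t = n a
      · subst h₂
        have h := hmul (n a)
        rw [hnn, add_comm (n a) a] at h
        rcases h with h | h
        · exact Or.inr ⟨a, ha, h⟩
        · left; rwa [h]
      rcases hbipot a ha t ht h₂ with h | h
      · exact Or.inr ⟨a, ha, by rw [add_right_comm, h]⟩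
      · left
        rw [add_right_comm, h, add_comm]
        rcases hbipot (n a) (hnT a ha) t ht (by rwa [hnn]) with h' | h' <;> rw [h']
        · exact hnT a ha
        · exact ht
  constructor
  · rcases he' with h | h
    · have h' : (1 : A) + n 1 + n 1 = 1 + n 1 := by
        simpa [hnadd, hnn, add_comm] using congrArg n h
      rw [← add_assoc, h, h']
    · rw [← add_assoc, h]
  · intro b
    obtain ⟨l, hl, rfl⟩ := hgen b
    induction l with
    | nil => exact Or.inl List.sum_nil
    | cons x l ih =>
      have ih' := ih fun y hy => hl y (List.mem_cons_of_mem x hy)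
      rw [List.sum_cons, add_comm]
      rcases hl x List.mem_cons_self with hx | hx
      · exact hstep x hx _ ih'
      · rwa [Set.mem_singleton_iff.mp hx, add_zero]
end

section
/- (∇-inversion when T is a group.) Let A be a semiring, T a submonoid of the multiplicative monoid of A such that every element of T has a multiplicative inverse lying in T, T₀ := T ∪ {0}, and n : A → A an additive monoid homomorphism with n ∘ n = id satisfying n(x·y) = x·n(y) = n(x)·y for all x, y ∈ A. Let I ⊆ A be an additive submonoid with n(I) ⊆ I, t·I ⊆ I for all t ∈ T, b + n(b) ∈ I for all b ∈ A, and I ∩ T = ∅. Assume A is tangibly balanced: for all b₁, b₂ ∈ A with b₁ + n(b₂) ∈ I, there exists a ∈ T₀ with a + n(b₁) ∈ I and a + n(b₂) ∈ I. Then for all a, a₁ ∈ T₀ and b ∈ A with a·b + n(a₁) ∈ I, there exists b' ∈ T₀ with a·b' = a₁ and b + n(b') ∈ I. -/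
/-- ∇-inversion when T is a group. A is a semiring, T a multiplicative
submonoid whose elements are invertible with inverses in T, n a negation map compatible
with multiplication, and I an additive submonoid stable under n and under multiplication
by T, containing all quasi-zeros and disjoint from T. If A is tangibly balanced, then for
all a, a₁ ∈ T₀ and b ∈ A with a·b ∇ a₁, there exists b' ∈ T₀ with a·b' = a₁ and b ∇ b'. -/
theorem stmt_12 {A : Type*} [Semiring A] (T : Set A) (n : A → A)
    (hT1 : (1 : A) ∈ T)
    (hTmul : ∀ a ∈ T, ∀ b ∈ T, a * b ∈ T)
    (hTinv : ∀ a ∈ T, ∃ b ∈ T, a * b = 1)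
    (hn0 : n 0 = 0)
    (hnadd : ∀ x y : A, n (x + y) = n x + n y)
    (hnn : ∀ x : A, n (n x) = x)
    (hnmull : ∀ x y : A, n (x * y) = x * n y)
    (hnmulr : ∀ x y : A, n (x * y) = n x * y)
    (I : AddSubmonoid A)
    (hnI : ∀ x ∈ I, n x ∈ I)
    (hTI : ∀ t ∈ T, ∀ x ∈ I, t * x ∈ I)
    (hq : ∀ b : A, b + n b ∈ I)
    (hdisj : (I : Set A) ∩ T = ∅)
    (htb : ∀ b₁ b₂ : A, b₁ + n b₂ ∈ I →
      ∃ a ∈ T ∪ {0}, a + n b₁ ∈ I ∧ a + n b₂ ∈ I) :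
    ∀ a ∈ T ∪ {0}, ∀ a₁ ∈ T ∪ {0}, ∀ b : A, a * b + n a₁ ∈ I →
      ∃ b' ∈ T ∪ {0}, a * b' = a₁ ∧ b + n b' ∈ I := by
  rintro a (ha | rfl) a₁ ha₁ b h
  · obtain ⟨c, hc, hac⟩ := hTinv a ha
    obtain ⟨d, -, hcd⟩ := hTinv c hc
    have hca : c * a = 1 := by
      rw [left_inv_eq_right_inv hac hcd, hcd]
    refine ⟨c * a₁, ?_, by rw [← mul_assoc, hac, one_mul], ?_⟩
    · rcases ha₁ with ha₁ | rfl
      · exact Or.inl (hTmul c hc a₁ ha₁)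
      · exact Or.inr (mul_zero c)
    · have hmem := hTI c hc _ h
      rwa [mul_add, ← mul_assoc, hca, one_mul, ← hnmull] at hmem
  · have ha₁I : a₁ ∈ I := by
      have hmem := hnI _ h
      rwa [zero_mul, zero_add, hnn] at hmem
    rcases ha₁ with ha₁ | rfl
    · exact ((hdisj.subset ⟨ha₁I, ha₁⟩ : a₁ ∈ (∅ : Set A))).elim
    · obtain ⟨b', hb', hbal, -⟩ := htb b b (hq b)
      refine ⟨b', hb', zero_mul b', ?_⟩
      have hmem := hnI _ hbal
      rwa [hnadd, hnn, add_comm] at hmem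
end

section
/- Let (A,+,0) be an additive commutative monoid, T ⊆ A, T₀ := T ∪ {0}, n : A → A an additive monoid homomorphism with n ∘ n = id and n(T) ⊆ T, and I ⊆ A an additive submonoid. Assume: (unique quasi-negation over I) for all x, y ∈ T₀, x + n(y) ∈ I implies x = y; (metatangibility) for all a, b ∈ T with b ≠ n(a), a + b ∈ T; and (second kind) n(a) ≠ a for all a ∈ T. Then for all a₁, a₂, a₃ ∈ T, if n(a₁) + a₂ + a₃ ∈ I and a₁ + a₂ + a₃ ∈ I, then a₂ = n(a₃). (Any metatangible system of the second kind is (−)-regular.) -/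
/-- Any metatangible system of the second kind is (−)-regular: with unique
quasi-negation of T₀ over I, metatangibility, and n(a) ≠ a for all a ∈ T, if
n(a₁) + a₂ + a₃ ∈ I and a₁ + a₂ + a₃ ∈ I for a₁, a₂, a₃ ∈ T, then a₂ = n(a₃). -/
theorem stmt_13 {A : Type*} [AddCommMonoid A] (T : Set A) (n : A → A)
    (hn0 : n 0 = 0)
    (hnadd : ∀ x y : A, n (x + y) = n x + n y)
    (hnn : ∀ x : A, n (n x) = x)
    (hnT : ∀ a ∈ T, n a ∈ T)
    (I : AddSubmonoid A)
    (huniq : ∀ x ∈ T ∪ {0}, ∀ y ∈ T ∪ {0}, x + n y ∈ I → x = y)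
    (hmeta : ∀ a ∈ T, ∀ b ∈ T, b ≠ n a → a + b ∈ T)
    (hsecond : ∀ a ∈ T, n a ≠ a) :
    ∀ a₁ ∈ T, ∀ a₂ ∈ T, ∀ a₃ ∈ T,
      n a₁ + a₂ + a₃ ∈ I → a₁ + a₂ + a₃ ∈ I → a₂ = n a₃ := by
  intro a₁ h₁ a₂ h₂ a₃ h₃ hneg hpos
  by_contra hne
  have hb : a₂ + a₃ ∈ T :=
    hmeta a₂ h₂ a₃ h₃ fun h => hne (by rw [h, hnn])
  have hb₁ : a₂ + a₃ = a₁ :=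
    huniq _ (Or.inl hb) _ (Or.inl h₁) (by rwa [add_comm, ← add_assoc])
  have hb₂ : a₂ + a₃ = n a₁ :=
    huniq _ (Or.inl hb) _ (Or.inl (hnT _ h₁)) (by rwa [hnn, add_comm, ← add_assoc])
  exact hsecond a₁ h₁ (hb₂.symm.trans hb₁)
end

section
/- Let (H, ⊞, 0) be a hypergroup (commutative multivalued addition, associative, 0 neutral, unique hypernegatives, and reversibility: a₁ ∈ a₂ ⊞ a₃ iff a₃ ∈ a₁ ⊞ (−a₂)). Assume H is regular on binary hypersums: for all b, c, a ∈ H, if a ∈ b ⊞ c and −a ∈ b ⊞ c then 0 ∈ b ⊞ c (this is implied by regularity of H). Then for all a₁, a₂, a₃ ∈ H: if 0 ∈ (−a₁) ⊞ (a₂ ⊞ a₃) and 0 ∈ a₁ ⊞ (a₂ ⊞ a₃), then a₂ = −a₃. (The hypersystem of a regular hyperfield is (−)-regular.) -/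
/-- Let (H, ⊞, 0) be a hypergroup (with reversibility) that is regular on
binary hypersums: a ∈ b ⊞ c and −a ∈ b ⊞ c imply 0 ∈ b ⊞ c. Then for all a₁, a₂, a₃:
if 0 ∈ (−a₁) ⊞ (a₂ ⊞ a₃) and 0 ∈ a₁ ⊞ (a₂ ⊞ a₃), then a₂ = −a₃. -/
theorem stmt_14 {H : Type*} (z : H) (add : H → H → Set H) (neg : H → H)
    (hne : ∀ a b : H, (add a b).Nonempty)
    (hcomm : ∀ a b : H, add a b = add b a)
    (hassoc : ∀ a b c : H, (⋃ x ∈ add a b, add x c) = (⋃ y ∈ add b c, add a y))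
    (hzero : ∀ a : H, add z a = {a})
    (hneg : ∀ a b : H, z ∈ add a b ↔ b = neg a)
    (hrev : ∀ a₁ a₂ a₃ : H, a₁ ∈ add a₂ a₃ ↔ a₃ ∈ add a₁ (neg a₂))
    (hreg : ∀ b c a : H, a ∈ add b c → neg a ∈ add b c → z ∈ add b c) :
    ∀ a₁ a₂ a₃ : H,
      z ∈ (⋃ y ∈ add a₂ a₃, add (neg a₁) y) →
      z ∈ (⋃ y ∈ add a₂ a₃, add a₁ y) →
      a₂ = neg a₃ := by
  have hnn : ∀ a : H, a = neg (neg a) := fun a =>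
    (hneg (neg a) a).1 (hcomm a (neg a) ▸ (hneg a (neg a)).2 rfl)
  intro a₁ a₂ a₃ h₁ h₂
  simp only [Set.mem_iUnion, hneg, exists_prop, exists_eq_right, ← hnn] at h₁ h₂
  have h := hreg a₂ a₃ a₁ h₁ h₂
  rw [hcomm] at h
  exact (hneg a₃ a₂).1 h
end

section
/- Let (A,+,0) be an additive commutative monoid, T ⊆ A, T₀ := T ∪ {0}, n : A → A an additive monoid homomorphism with n ∘ n = id and n(T₀) ⊆ T₀, and I ⊆ A an additive submonoid with n(I) ⊆ I and b + n(b) ∈ I for all b ∈ A. Assume tangible balance elimination: for all a ∈ T₀ and b₁, b₂ ∈ A, if b₁ + n(a) ∈ I and a + n(b₂) ∈ I then b₁ + n(b₂) ∈ I. Then for all b₁, b₂, b₃ ∈ A, (b₁ ⊞∇ b₂) ⊞∇ b₃ ⊆ b₁ ⊞∇ b₂ ⊞∇ b₃; explicitly, if a ∈ T₀ and there exists c ∈ T₀ with c + n(b₁ + b₂) ∈ I and a + n(c + b₃) ∈ I, then a + n(b₁ + b₂ + b₃) ∈ I. -/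
/-- Under tangible balance elimination, (b₁ ⊞∇ b₂) ⊞∇ b₃ ⊆ b₁ ⊞∇ b₂ ⊞∇ b₃:
if a ∈ T₀ and there exists c ∈ T₀ with c ∇ (b₁ + b₂) and a ∇ (c + b₃), then
a ∇ (b₁ + b₂ + b₃). -/
theorem stmt_15 {A : Type*} [AddCommMonoid A] (T : Set A) (n : A → A)
    (hn0 : n 0 = 0)
    (hnadd : ∀ x y : A, n (x + y) = n x + n y)
    (hnn : ∀ x : A, n (n x) = x)
    (hnT : ∀ a ∈ T ∪ {0}, n a ∈ T ∪ {0})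
    (I : AddSubmonoid A)
    (hnI : ∀ x ∈ I, n x ∈ I)
    (hq : ∀ b : A, b + n b ∈ I)
    (htbe : ∀ a ∈ T ∪ {0}, ∀ b₁ b₂ : A,
      b₁ + n a ∈ I → a + n b₂ ∈ I → b₁ + n b₂ ∈ I) :
    ∀ b₁ b₂ b₃ : A, ∀ a ∈ T ∪ {0},
      (∃ c ∈ T ∪ {0}, c + n (b₁ + b₂) ∈ I ∧ a + n (c + b₃) ∈ I) →
      a + n (b₁ + b₂ + b₃) ∈ I := by
  rintro b₁ b₂ b₃ a - ⟨c, hc, hcb, hac⟩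
  have h := htbe c hc (a + n b₃) (b₁ + b₂)
    (by rwa [add_assoc, add_comm (n b₃), ← hnadd]) hcb
  rwa [add_assoc, ← hnadd, add_comm b₃] at h
end

section
/- Let (A,+,0) be an additive commutative monoid, T ⊆ A, T₀ := T ∪ {0}, n : A → A an additive monoid homomorphism with n ∘ n = id and n(T₀) ⊆ T₀, and I ⊆ A an additive submonoid with n(I) ⊆ I and b + n(b) ∈ I for all b ∈ A. Assume A is tangibly balanced: for all b₁, b₂ ∈ A with b₁ + n(b₂) ∈ I, there exists c ∈ T₀ with c + n(b₁) ∈ I and c + n(b₂) ∈ I. Then for all b₁, b₂, b₃ ∈ A, b₁ ⊞∇ b₂ ⊞∇ b₃ ⊆ (b₁ ⊞∇ b₂) ⊞∇ b₃; explicitly, if a ∈ T₀ and a + n(b₁ + b₂ + b₃) ∈ I, then there exists c ∈ T₀ with c + n(b₁ + b₂) ∈ I and a + n(c + b₃) ∈ I. -/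
/-- If A is tangibly balanced, then b₁ ⊞∇ b₂ ⊞∇ b₃ ⊆ (b₁ ⊞∇ b₂) ⊞∇ b₃:
if a ∈ T₀ and a ∇ (b₁ + b₂ + b₃), then there exists c ∈ T₀ with c ∇ (b₁ + b₂) and
a ∇ (c + b₃). -/
theorem stmt_16 {A : Type*} [AddCommMonoid A] (T : Set A) (n : A → A)
    (hn0 : n 0 = 0)
    (hnadd : ∀ x y : A, n (x + y) = n x + n y)
    (hnn : ∀ x : A, n (n x) = x)
    (hnT : ∀ a ∈ T ∪ {0}, n a ∈ T ∪ {0})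
    (I : AddSubmonoid A)
    (hnI : ∀ x ∈ I, n x ∈ I)
    (hq : ∀ b : A, b + n b ∈ I)
    (htb : ∀ b₁ b₂ : A, b₁ + n b₂ ∈ I →
      ∃ c ∈ T ∪ {0}, c + n b₁ ∈ I ∧ c + n b₂ ∈ I) :
    ∀ b₁ b₂ b₃ : A, ∀ a ∈ T ∪ {0}, a + n (b₁ + b₂ + b₃) ∈ I →
      ∃ c ∈ T ∪ {0}, c + n (b₁ + b₂) ∈ I ∧ a + n (c + b₃) ∈ I := by
  intro b₁ b₂ b₃ a _ h
  obtain ⟨c, hc, hcy, hcx⟩ := htb (a + n b₃) (b₁ + b₂) (by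
    rwa [hnadd (b₁ + b₂), add_comm (n (b₁ + b₂)), ← add_assoc] at h)
  refine ⟨c, hc, hcx, ?_⟩
  have h' := hnI _ hcy
  rwa [hnadd c, hnn, add_left_comm, ← hnadd] at h'
end

section
/- (Associativity in the hyperring recovered from a system.) Let (A,+,0) be an additive commutative monoid, T ⊆ A, T₀ := T ∪ {0}, n : A → A an additive monoid homomorphism with n ∘ n = id and n(T₀) ⊆ T₀, and I ⊆ A an additive submonoid with n(I) ⊆ I and b + n(b) ∈ I for all b ∈ A. Assume A is tangibly balanced (for all b₁, b₂ ∈ A with b₁ + n(b₂) ∈ I there exists c ∈ T₀ with c + n(b₁) ∈ I and c + n(b₂) ∈ I) and satisfies tangible balance elimination (for all a ∈ T₀ and b₁, b₂ ∈ A, b₁ + n(a) ∈ I and a + n(b₂) ∈ I imply b₁ + n(b₂) ∈ I). Then for all a₁, a₂, a₃ ∈ T₀ the three sets (a₁ ⊞∇ a₂) ⊞∇ a₃, {a ∈ T₀ : a + n(a₁ + a₂ + a₃) ∈ I}, and a₁ ⊞∇ (a₂ ⊞∇ a₃) coincide; in particular ⊞∇ is associative on T₀. -/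
/-- Under tangible balancing and balance elimination, `a ∇ s + b` holds exactly when
`a ∇ c + b` for some tangible-or-zero `c ∇ s`. -/
theorem exists_tangible_balance_iff {A : Type*} [AddCommMonoid A] {T₀ : Set A} {n : A → A}
    (hnadd : ∀ x y : A, n (x + y) = n x + n y)
    (hnn : ∀ x : A, n (n x) = x)
    {I : AddSubmonoid A}
    (hnI : ∀ x ∈ I, n x ∈ I)
    (htb : ∀ b₁ b₂ : A, b₁ + n b₂ ∈ I → ∃ c ∈ T₀, c + n b₁ ∈ I ∧ c + n b₂ ∈ I)
    (htbe : ∀ a ∈ T₀, ∀ b₁ b₂ : A, b₁ + n a ∈ I → a + n b₂ ∈ I → b₁ + n b₂ ∈ I)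
    (a s b : A) :
    (∃ c ∈ T₀, c + n s ∈ I ∧ a + n (c + b) ∈ I) ↔ a + n (s + b) ∈ I := by
  have move (x : A) : a + n (x + b) = a + n b + n x := by
    rw [hnadd, add_comm (n x), add_assoc]
  simp only [move]
  constructor
  · rintro ⟨c, hc, hcs, hac⟩
    exact htbe c hc _ _ hac hcs
  · intro h
    obtain ⟨c, hc, hca, hcs⟩ := htb _ _ h
    refine ⟨c, hc, hcs, ?_⟩
    have hneg := hnI _ hca
    rwa [hnadd, hnn, add_comm] at hneg


/-- Associativity in the hyperring recovered from a system. Under tangible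
balancing and tangible balance elimination, for all a₁, a₂, a₃ ∈ T₀ the sets
(a₁ ⊞∇ a₂) ⊞∇ a₃, {a ∈ T₀ : a ∇ (a₁+a₂+a₃)}, and a₁ ⊞∇ (a₂ ⊞∇ a₃) coincide. -/
theorem stmt_17 {A : Type*} [AddCommMonoid A] (T : Set A) (n : A → A)
    (hn0 : n 0 = 0)
    (hnadd : ∀ x y : A, n (x + y) = n x + n y)
    (hnn : ∀ x : A, n (n x) = x)
    (hnT : ∀ a ∈ T ∪ {0}, n a ∈ T ∪ {0})
    (I : AddSubmonoid A)
    (hnI : ∀ x ∈ I, n x ∈ I)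
    (hq : ∀ b : A, b + n b ∈ I)
    (htb : ∀ b₁ b₂ : A, b₁ + n b₂ ∈ I →
      ∃ c ∈ T ∪ {0}, c + n b₁ ∈ I ∧ c + n b₂ ∈ I)
    (htbe : ∀ a ∈ T ∪ {0}, ∀ b₁ b₂ : A,
      b₁ + n a ∈ I → a + n b₂ ∈ I → b₁ + n b₂ ∈ I) :
    ∀ a₁ ∈ T ∪ {0}, ∀ a₂ ∈ T ∪ {0}, ∀ a₃ ∈ T ∪ {0},
      ({a ∈ T ∪ {0} | ∃ c ∈ T ∪ {0}, c + n (a₁ + a₂) ∈ I ∧ a + n (c + a₃) ∈ I}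
          = {a ∈ T ∪ {0} | a + n (a₁ + a₂ + a₃) ∈ I}) ∧
      ({a ∈ T ∪ {0} | a + n (a₁ + a₂ + a₃) ∈ I}
          = {a ∈ T ∪ {0} | ∃ c ∈ T ∪ {0}, c + n (a₂ + a₃) ∈ I ∧ a + n (a₁ + c) ∈ I}) := by
  intro a₁ _ a₂ _ a₃ _
  have key := exists_tangible_balance_iff hnadd hnn hnI htb htbe
  constructor <;> ext a
  · exact and_congr_right fun _ => key a (a₁ + a₂) a₃
  · refine and_congr_right fun _ => ?_
    simpa only [add_comm a₁, add_right_comm a₂ a₁ a₃] using (key a (a₂ + a₃) a₁).symm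
end
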